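/- Let A be a Banach algebra such that the quotient A/ran(A) by the right annihilator is commutative and semisimple (its Jacobson radical is zero). Then every derivation of A is spectrally infinitesimal, i.e., the spectral radius of d(a) is zero for every a ∈ A. -/

import Mathlib

/-- The right annihilator `ran(A) = {x | ∀ a, a * x = 0}` of `A`, as a two-sided ideal. -/
def ranIdeal (A : Type*) [NonUnitalNormedRing A] : TwoSidedIdeal A :=
  TwoSidedIdeal.mk' {x | ∀ a : A, a * x = 0}
    (fun a => mul_zero a)
    (fun hx hy a => by rw [mul_add, hx a, hy a, add_zero])
    (fun hx a => by rw [mul_neg, hx a, neg_zero])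
    (fun {x y} hy a => by rw [← mul_assoc, hy (a * x)])
    (fun {x y} hx a => by rw [← mul_assoc, hx a, zero_mul])

/-- The quotient algebra `A / ran(A)`. -/
abbrev RanQuot (A : Type*) [NonUnitalNormedRing A] := (ranIdeal A).ringCon.Quotient

/-- Characters (possibly zero) of a Banach algebra are contractive. -/
lemma char_norm_le {A : Type*} [NonUnitalNormedRing A] [NormedSpace ℂ A]
    [IsScalarTower ℂ A A] [SMulCommClass ℂ A A] [CompleteSpace A] (φ : A →ₙₐ[ℂ] ℂ) (x : A) :
    ‖φ x‖ ≤ ‖x‖ := by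
  by_contra! h
  have h0 : φ x ≠ 0 := by
    intro h1
    rw [h1, norm_zero] at h
    exact absurd h (not_lt.mpr (norm_nonneg _))
  set y : A := (φ x)⁻¹ • x with hy
  have hφy : φ y = 1 := by rw [hy, map_smul, smul_eq_mul, inv_mul_cancel₀ h0]
  have hyn : ‖y‖ < 1 := by
    rw [hy, norm_smul, norm_inv, inv_mul_lt_iff₀ (by positivity)]
    simpa using h
  let T : ℕ → A := fun n => (fun z => y * z)^[n] y
  have hT : ∀ n, ‖T n‖ ≤ ‖y‖ * ‖y‖ ^ n := by
    intro n
    induction n with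
    | zero => simp [T]
    | succ n ih =>
      have : T (n + 1) = y * T n := Function.iterate_succ_apply' _ _ _
      rw [this]
      calc ‖y * T n‖ ≤ ‖y‖ * ‖T n‖ := norm_mul_le _ _
        _ ≤ ‖y‖ * (‖y‖ * ‖y‖ ^ n) := by gcongr
        _ = _ := by ring
  have hs : Summable T := Summable.of_norm_bounded
    ((summable_geometric_of_lt_one (norm_nonneg _) hyn).mul_left _) hT
  have h1 : ∑' n, T n = y + y * ∑' n, T n := by
    rw [← hs.tsum_mul_left]
    refine (hs.tsum_eq_zero_add).trans ?_
    congr 1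
    exact tsum_congr fun n => Function.iterate_succ_apply' _ _ _
  have h2 := congrArg φ h1
  rw [map_add, map_mul, hφy, one_mul] at h2
  simp at h2

lemma char_continuous {A : Type*} [NonUnitalNormedRing A] [NormedSpace ℂ A]
    [IsScalarTower ℂ A A] [SMulCommClass ℂ A A] [CompleteSpace A] (φ : A →ₙₐ[ℂ] ℂ) :
    Continuous φ :=
  AddMonoidHomClass.continuous_of_bound φ 1 (by simpa using char_norm_le φ)

/-- A commuting family of elements in a Banach algebra sits in a closed commutative subalgebra, and
invertibility is detected by its characters. -/
lemma surj_of_char {A : Type*} [NonUnitalNormedRing A] [NormedSpace ℂ A]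
    [IsScalarTower ℂ A A] [SMulCommClass ℂ A A] [CompleteSpace A]
    (hc : ∀ a x y : A, a * (x * y) = a * (y * x)) (w : A) (hw : ∀ φ : A →ₙₐ[ℂ] ℂ, φ w = 0) :
    ∃ z : A, z + w + z * w = 0 := by
  let R : A → (A →L[ℂ] A) := fun x => (ContinuousLinearMap.mul ℂ A).flip x
  have hR : ∀ x a, R x a = a * x := fun x a => rfl
  let S : Subalgebra ℂ (A →L[ℂ] A) := Subalgebra.centralizer ℂ
    (Subalgebra.centralizer ℂ (Set.range R) : Set (A →L[ℂ] A))
  have hRR : ∀ x y, R x * R y = R y * R x := by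
    intro x y
    ext a
    simp only [ContinuousLinearMap.mul_apply, hR]
    rw [mul_assoc, mul_assoc, hc]
  have hRS : ∀ x, R x ∈ S := by
    intro x
    rw [Subalgebra.mem_centralizer_iff]
    intro g hg
    exact ((Subalgebra.mem_centralizer_iff ℂ).1 hg _ ⟨x, rfl⟩).symm
  have hSS : ∀ f ∈ S, ∀ g ∈ S, f * g = g * f := by
    intro f hf g hg
    rw [Subalgebra.mem_centralizer_iff] at hg
    refine hg f ?_
    refine (Subalgebra.mem_centralizer_iff ℂ).2 ?_
    intro h hh
    rw [Subalgebra.mem_centralizer_iff] at hf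
    refine hf h ?_
    refine (Subalgebra.mem_centralizer_iff ℂ).2 ?_
    rintro _ ⟨x, rfl⟩
    obtain ⟨y, rfl⟩ := hh
    exact hRR x y
  have hcl : IsClosed (S : Set (A →L[ℂ] A)) := by
    have : (S : Set (A →L[ℂ] A)) = ⋂ g ∈ (Subalgebra.centralizer ℂ (Set.range R) :
        Set (A →L[ℂ] A)), {f | g * f = f * g} := by
      ext f
      simp only [Set.mem_iInter, Set.mem_setOf_eq]
      exact Subalgebra.mem_centralizer_iff ℂ
    rw [this]
    refine isClosed_biInter fun g _ => isClosed_eq (by fun_prop) (by fun_prop)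
  let _ : NormedCommRing S :=
    { (inferInstance : NormedRing S) with
      mul_comm := fun f g => Subtype.ext (hSS f.1 f.2 g.1 g.2) }
  have : CompleteSpace S := hcl.completeSpace_coe
  have hu : IsUnit ((1 : S) + ⟨R w, hRS w⟩) := by
    by_contra hn
    obtain ⟨f, hf⟩ := WeakDual.CharacterSpace.exists_apply_eq_zero hn
    let φ : A →ₙₐ[ℂ] ℂ :=
      { toFun := fun x => f ⟨R x, hRS x⟩
        map_smul' := fun c x => by
          rw [MonoidHom.id_apply, ← map_smul]
          congr 1
          ext a
          simp [hR, mul_smul_comm]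
        map_zero' := by
          rw [← map_zero f]
          congr 1
          ext a
          simp [hR]
        map_add' := fun x y => by
          rw [← map_add]
          congr 1
          ext a
          simp [hR, mul_add]
        map_mul' := fun x y => by
          rw [← map_mul]
          congr 1
          ext a
          simp [hR, mul_assoc, hc a x y] }
    have h1 : f ⟨R w, hRS w⟩ = 0 := hw φ
    rw [map_add, map_one, h1] at hf
    simp at hf
  obtain ⟨v, hv⟩ := hu.exists_right_inv
  have hv' : (1 + R w) * (v : A →L[ℂ] A) = 1 := congrArg Subtype.val hv
  refine ⟨(v : A →L[ℂ] A) (-w), ?_⟩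
  have h3 := congrArg (fun T : A →L[ℂ] A => T (-w)) hv'
  simp only [ContinuousLinearMap.mul_apply, ContinuousLinearMap.add_apply,
    ContinuousLinearMap.one_apply, hR] at h3
  rw [add_right_comm, h3]
  simp

lemma mem_ranIdeal_iff {A : Type*} [NonUnitalNormedRing A] (x : A) :
    x ∈ ranIdeal A ↔ ∀ a : A, a * x = 0 := by
  unfold ranIdeal
  rw [TwoSidedIdeal.mem_mk']
  rfl

lemma ranQuot_eq_iff {A : Type*} [NonUnitalNormedRing A] (x y : A) :
    ((x : RanQuot A) = (y : RanQuot A)) ↔ ∀ a : A, a * (x - y) = 0 := by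
  rw [← mem_ranIdeal_iff, TwoSidedIdeal.mem_iff, RingCon.eq]
  exact TwoSidedIdeal.rel_iff _ _ _

lemma ran_of_char {A : Type*} [NonUnitalNormedRing A] [NormedSpace ℂ A]
    [IsScalarTower ℂ A A] [SMulCommClass ℂ A A] [CompleteSpace A]
    (hcomm : ∀ x y : RanQuot A, x * y = y * x)
    (hss : ∀ x : RanQuot A,
      (↑x : Unitization ℤ (RanQuot A)) ∈ (⊥ : Ideal (Unitization ℤ (RanQuot A))).jacobson →
        x = 0) (x : A) (hx : ∀ φ : A →ₙₐ[ℂ] ℂ, φ x = 0) : ∀ a : A, a * x = 0 := by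
  have hc : ∀ a x y : A, a * (x * y) = a * (y * x) := by
    intro a x y
    have := (ranQuot_eq_iff (x * y) (y * x)).1 (hcomm x y) a
    rwa [mul_sub, sub_eq_zero] at this
  have h0 : ((x : A) : RanQuot A) = ((0 : A) : RanQuot A) := by
    refine hss _ ?_
    rw [Ideal.mem_jacobson_iff]
    intro y
    induction y using Unitization.ind with
    | inl_add_inr n b =>
    obtain ⟨b, rfl⟩ : ∃ b' : A, (b' : RanQuot A) = b := Quotient.exists_rep b
    obtain ⟨z, hz⟩ := surj_of_char hc (n • x + b * x) (by
      intro φ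
      rw [map_add, map_mul, hx, map_zsmul, hx]; simp)
    refine ⟨1 + ((z : RanQuot A) : Unitization ℤ (RanQuot A)), ?_⟩
    rw [Ideal.mem_bot]
    have e1 : (Unitization.inl n + ((b : RanQuot A) : Unitization ℤ (RanQuot A))) *
        ((x : RanQuot A) : Unitization ℤ (RanQuot A)) =
        (((n • x + b * x : A) : RanQuot A) : Unitization ℤ (RanQuot A)) := by
      rw [add_mul, Unitization.inl_mul_inr, ← Unitization.inr_mul, ← Unitization.inr_add]
      rfl
    have e2 : (((z + (n • x + b * x) + z * (n • x + b * x) : A) : RanQuot A) :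
        Unitization ℤ (RanQuot A)) = 0 := by
      rw [hz]; rfl
    rw [mul_assoc, e1, add_mul, one_mul, ← Unitization.inr_mul]
    rw [show (((z + (n • x + b * x) + z * (n • x + b * x) : A) : RanQuot A)) =
      (z : RanQuot A) + ((n • x + b * x : A) : RanQuot A)
        + (z : RanQuot A) * ((n • x + b * x : A) : RanQuot A) from rfl,
      Unitization.inr_add, Unitization.inr_add] at e2
    rw [← e2]
    abel
  have := (ranQuot_eq_iff x 0).1 h0
  simpa using this

section Johnson

variable {A : Type*} [NonUnitalNormedRing A] [NormedSpace ℂ A]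
    [IsScalarTower ℂ A A] [SMulCommClass ℂ A A]

/-- Distinct nonzero characters have incomparable kernels. -/
lemma char_separate (φ ψ : A →ₙₐ[ℂ] ℂ) (hφ : ∃ x, φ x ≠ 0) (hne : φ ≠ ψ) :
    ∃ b, ψ b = 0 ∧ φ b ≠ 0 := by
  by_contra! h
  by_cases hψ : ∃ y, ψ y ≠ 0
  · obtain ⟨y, hy⟩ := hψ
    set e : A := (ψ y)⁻¹ • y with he
    have hψe : ψ e = 1 := by rw [he, map_smul, smul_eq_mul, inv_mul_cancel₀ hy]
    have key : ∀ x, φ x = φ e * ψ x := by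
      intro x
      have := h (x - ψ x • e) (by rw [map_sub, map_smul, hψe]; simp)
      rw [map_sub, map_smul, sub_eq_zero] at this
      rw [this, smul_eq_mul, mul_comm]
    have hee : φ e * φ e = φ e := by
      rw [← map_mul, key (e * e), map_mul, hψe]; simp
    obtain ⟨x, hx⟩ := hφ
    have hφe : φ e ≠ 0 := by
      intro h0; exact hx (by rw [key, h0, zero_mul])
    have h1 : φ e = 1 := mul_left_cancel₀ hφe (by rw [hee, mul_one])
    exact hne (NonUnitalAlgHom.ext fun x => by rw [key x, h1, one_mul])
  · push Not at hψ
    obtain ⟨x, hx⟩ := hφ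
    exact hx (h x (hψ x))

variable (d : A →ₗ[ℂ] A)

/-- Intersection of kernels of a set of characters. -/
def kerInter (G : Set (A →ₙₐ[ℂ] ℂ)) : Submodule ℂ A where
  carrier := {x | ∀ ψ ∈ G, ψ x = 0}
  add_mem' := fun ha hb ψ hψ => by rw [map_add, ha ψ hψ, hb ψ hψ, add_zero]
  zero_mem' := fun ψ _ => map_zero ψ
  smul_mem' := fun c x hx ψ hψ => by rw [map_smul, hx ψ hψ, smul_zero]

lemma mem_kerInter (G : Set (A →ₙₐ[ℂ] ℂ)) (x : A) : x ∈ kerInter G ↔ ∀ ψ ∈ G, ψ x = 0 := Iff.rfl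

variable [CompleteSpace A]

lemma kerInter_isClosed (G : Set (A →ₙₐ[ℂ] ℂ)) : IsClosed (kerInter G : Set A) := by
  have : (kerInter G : Set A) = ⋂ ψ ∈ G, {x | ψ x = 0} := by
    ext x
    simp [mem_kerInter]
  rw [this]
  exact isClosed_biInter fun ψ _ => isClosed_eq (char_continuous ψ) continuous_const

/-- A character vanishing on a closed submodule descends continuously to the quotient. -/
lemma exists_lift (φ : A →ₙₐ[ℂ] ℂ) (I : Submodule ℂ A) (h : ∀ x ∈ I, φ x = 0) :
    ∃ f : (A ⧸ I) →ₗ[ℂ] ℂ, Continuous f ∧ ∀ x, f (I.mkQ x) = φ x := by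
  refine ⟨I.liftQ (φ : A →ₗ[ℂ] ℂ) (fun x hx => h x hx), ?_, fun x => rfl⟩
  exact I.isOpenQuotientMap_mkQ.isQuotientMap.continuous_iff.2 (char_continuous φ)

/-- Closed graph argument. -/
lemma mkQ_comp_continuous (G : Set (A →ₙₐ[ℂ] ℂ)) (hG : ∀ ψ ∈ G, Continuous (fun x => ψ (d x))) :
    Continuous ((kerInter G).mkQ ∘ₗ d) := by
  have := kerInter_isClosed G
  refine LinearMap.continuous_of_seq_closed_graph _ fun u x y hu hy => ?_
  obtain ⟨y, rfl⟩ := (kerInter G).mkQ_surjective y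
  rw [LinearMap.comp_apply, ← sub_eq_zero, ← map_sub, Submodule.mkQ_apply,
    Submodule.Quotient.mk_eq_zero]
  intro ψ hψ
  obtain ⟨f, hf, hfψ⟩ := exists_lift ψ (kerInter G) (fun x hx => hx ψ hψ)
  have h1 := (hf.tendsto _).comp hy
  have h2 := ((hG ψ hψ).tendsto x).comp hu
  rw [hfψ] at h1
  have h3 : (f ∘ (⇑((kerInter G).mkQ ∘ₗ d) ∘ u)) = ((fun x => ψ (d x)) ∘ u) := by
    ext n
    exact hfψ _
  rw [h3] at h1
  rw [map_sub, sub_eq_zero]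
  exact tendsto_nhds_unique h1 h2

/-- If the functional `φ ∘ d` is discontinuous, it is large on small vectors. -/
lemma exists_large (φ : A →ₙₐ[ℂ] ℂ) (h : ¬ Continuous (fun x => φ (d x))) (ε M : ℝ) (hε : 0 < ε) :
    ∃ z, ‖z‖ ≤ ε ∧ M ≤ ‖φ (d z)‖ := by
  by_contra! hcon
  apply h
  have hM : 0 < M := (norm_nonneg _).trans_lt (hcon 0 (by simpa using hε.le))
  refine AddMonoidHomClass.continuous_of_bound ((φ : A →ₗ[ℂ] ℂ) ∘ₗ d) (M / ε) (fun x => ?_)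
  change ‖φ (d x)‖ ≤ M / ε * ‖x‖
  by_cases hx : x = 0
  · simp [hx]
  have hx' : 0 < ‖x‖ := norm_pos_iff.2 hx
  have h1 := hcon (((ε / ‖x‖ : ℝ) : ℂ) • x) (by
    rw [norm_smul, Complex.norm_real, Real.norm_eq_abs, abs_of_pos (by positivity)]
    field_simp; exact le_rfl)
  rw [map_smul, map_smul, norm_smul, Complex.norm_real, Real.norm_eq_abs,
    abs_of_pos (by positivity)] at h1
  rw [div_mul_eq_mul_div, div_lt_iff₀ hx'] at h1
  rw [div_mul_eq_mul_div, le_div_iff₀ hε]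
  linarith

lemma exists_small_scale (b : A) : ∃ c : ℂ, c ≠ 0 ∧ ‖c • b‖ ≤ 1 := by
  refine ⟨((1 / (‖b‖ + 1) : ℝ) : ℂ), ?_, ?_⟩
  · have : (1 / (‖b‖ + 1) : ℝ) ≠ 0 := by positivity
    exact_mod_cast this
  · rw [norm_smul, Complex.norm_real, Real.norm_eq_abs, abs_of_pos (by positivity)]
    rw [div_mul_eq_mul_div, div_le_one (by positivity)]
    linarith

/-- Baire: an element killed by `φ` but not by any of countably many other characters. -/
lemma exists_baire (φ : A →ₙₐ[ℂ] ℂ) (ψ : ℕ → A →ₙₐ[ℂ] ℂ) (h0 : ∀ n, ∃ x, ψ n x ≠ 0)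
    (hne : ∀ n, ψ n ≠ φ) : ∃ b, φ b = 0 ∧ ‖b‖ ≤ 1 ∧ ∀ n, ψ n b ≠ 0 := by
  have hcl := kerInter_isClosed ({φ} : Set (A →ₙₐ[ℂ] ℂ))
  have : CompleteSpace (kerInter ({φ} : Set (A →ₙₐ[ℂ] ℂ))) := hcl.completeSpace_coe
  let K := kerInter ({φ} : Set (A →ₙₐ[ℂ] ℂ))
  suffices ∃ b : K, ∀ n, ψ n b ≠ 0 by
    obtain ⟨b, hb⟩ := this
    obtain ⟨c, hc, hcb⟩ := exists_small_scale (b : A)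
    refine ⟨c • (b : A), ?_, hcb, fun n => ?_⟩
    · rw [map_smul, b.2 φ rfl, smul_zero]
    · rw [map_smul]
      exact smul_ne_zero hc (hb n)
  by_contra! hcon
  let f : ℕ → Submodule ℂ K := fun n =>
    LinearMap.ker ((ψ n : A →ₗ[ℂ] ℂ) ∘ₗ K.subtype)
  obtain ⟨n, hn⟩ := nonempty_interior_of_iUnion_of_closed (X := K) (f := fun n => (f n : Set K))
    (fun n => by
      have : (f n : Set K) = {x : K | ψ n x = 0} := by ext x; rfl
      rw [this]
      exact isClosed_eq ((char_continuous _).comp continuous_subtype_val) continuous_const)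
    (by
      ext x
      obtain ⟨n, hn⟩ := hcon x
      simp only [Set.mem_iUnion, Set.mem_univ, iff_true]
      exact ⟨n, hn⟩)
  have htop := (f n).eq_top_of_nonempty_interior' hn
  obtain ⟨b, hb, hb'⟩ := char_separate (ψ n) φ (h0 n) (hne n)
  have hbK : b ∈ K := by
    intro χ hχ
    rw [Set.mem_singleton_iff.1 hχ, hb]
  have : (⟨b, hbK⟩ : K) ∈ f n := by rw [htop]; trivial
  exact hb' this


/-- Gliding hump: there is no infinite sequence of distinct characters with `φ ∘ d`
discontinuous. -/
lemma no_sequence (hd : ∀ a x : A, d (a * x) = d a * x + a * d x)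
    (φ : ℕ → A →ₙₐ[ℂ] ℂ) (hinj : Function.Injective φ)
    (hdisc : ∀ n, ¬ Continuous (fun x => φ n (d x))) : False := by
  have hnz : ∀ n, ∃ x, φ n x ≠ 0 := by
    intro n
    by_contra! h
    exact hdisc n (by simpa [h] using continuous_const)
  have hb : ∀ n, ∃ b, φ n b = 0 ∧ ‖b‖ ≤ 1 ∧ ∀ m, φ (n + 1 + m) b ≠ 0 := fun n =>
    exists_baire (φ n) (fun m => φ (n + 1 + m)) (fun m => hnz _)
      (fun m h => by have := hinj h; omega)
  choose b hb0 hb1 hbne using hb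
  let L : ℕ → A →ₗ[ℂ] A := fun n =>
    Nat.rec LinearMap.id (fun n f => f ∘ₗ LinearMap.mulLeft ℂ (b n)) n
  have hL0 : ∀ z, L 0 z = z := fun z => rfl
  have hLs : ∀ n z, L (n + 1) z = L n (b n * z) := fun n z => rfl
  have hL : ∀ (χ : A →ₙₐ[ℂ] ℂ) n, ∃ β : ℂ, ∀ z,
      χ (d (L n z)) = (∏ i ∈ Finset.range n, χ (b i)) * χ (d z) + β * χ z := by
    intro χ n
    induction n with
    | zero => exact ⟨0, fun z => by simp [hL0]⟩
    | succ n ih =>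
      obtain ⟨β, hβ⟩ := ih
      refine ⟨(∏ i ∈ Finset.range n, χ (b i)) * χ (d (b n)) + β * χ (b n), fun z => ?_⟩
      rw [hLs, hβ, hd, map_add, map_mul, map_mul, map_mul, Finset.prod_range_succ]
      ring
  have hα : ∀ n, (∏ i ∈ Finset.range n, φ n (b i)) ≠ 0 := by
    intro n
    refine Finset.prod_ne_zero_iff.2 fun i hi => ?_
    have := hbne i (n - (i + 1))
    rwa [Nat.add_sub_cancel' (Finset.mem_range.1 hi)] at this
  choose β hβ using fun n => hL (φ n) n
  generalize hαdef : (fun n => ∏ i ∈ Finset.range n, φ n (b i)) = α at *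
  have hα' : ∀ n, α n ≠ 0 := fun n => by rw [← hαdef]; exact hα n
  have hβ' : ∀ n z, φ n (d (L n z)) = α n * φ n (d z) + β n * φ n z := fun n z => by
    rw [← hαdef]; exact hβ n z
  have hx : ∀ (n : ℕ) (g : A), ∃ z, ‖z‖ ≤ (1 / 2 : ℝ) ^ n ∧
      n + ‖φ n (d g)‖ + 2 * ‖α n‖ * ‖φ n (d (b n))‖ ≤ ‖φ n (d (L n z))‖ := by
    intro n g
    have hαp : 0 < ‖α n‖ := norm_pos_iff.2 (hα' n)
    obtain ⟨z, hz, hz'⟩ := exists_large d (φ n) (hdisc n) ((1 / 2 : ℝ) ^ n)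
      ((n + ‖φ n (d g)‖ + 2 * ‖α n‖ * ‖φ n (d (b n))‖ + ‖β n‖) / ‖α n‖) (by positivity)
    refine ⟨z, hz, ?_⟩
    rw [div_le_iff₀ hαp] at hz'
    have h1 : ‖β n * φ n z‖ ≤ ‖β n‖ := by
      rw [norm_mul]
      refine mul_le_of_le_one_right (norm_nonneg _) ?_
      exact (char_norm_le _ _).trans (hz.trans (pow_le_one₀ (by norm_num) (by norm_num)))
    have h2 : ‖α n * φ n (d z)‖ - ‖β n * φ n z‖ ≤ ‖α n * φ n (d z) + β n * φ n z‖ := by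
      have := norm_sub_le (α n * φ n (d z) + β n * φ n z) (β n * φ n z)
      rw [add_sub_cancel_right] at this
      linarith
    rw [hβ']
    rw [norm_mul] at h2
    linarith
  choose X hX1 hX2 using hx
  let G : ℕ → A := fun n => Nat.rec 0 (fun n g => g + L n (X n g)) n
  let x : ℕ → A := fun n => X n (G n)
  have hG : ∀ n, G (n + 1) = G n + L n (x n) := fun n => rfl
  let T : ℕ → ℕ → A := fun m => Nat.rec x (fun _ f n => b n * f (n + 1)) m
  have hT0 : ∀ n, T 0 n = x n := fun n => rfl
  have hTs : ∀ m n, T (m + 1) n = b n * T m (n + 1) := fun m n => rfl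
  have hTn : ∀ m n, ‖T m n‖ ≤ (1 / 2 : ℝ) ^ n * (1 / 2 : ℝ) ^ m := by
    intro m
    induction m with
    | zero => intro n; rw [hT0, pow_zero, mul_one]; exact hX1 n (G n)
    | succ m ih =>
      intro n
      rw [hTs]
      calc ‖b n * T m (n + 1)‖ ≤ ‖b n‖ * ‖T m (n + 1)‖ := norm_mul_le _ _
        _ ≤ 1 * ((1 / 2 : ℝ) ^ (n + 1) * (1 / 2 : ℝ) ^ m) := by
            gcongr
            · exact hb1 n
            · exact ih _
        _ = _ := by ring
  have hgeo : ∀ n : ℕ, HasSum (fun m : ℕ => (1 / 2 : ℝ) ^ n * (1 / 2 : ℝ) ^ m)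
      ((1 / 2 : ℝ) ^ n * 2) := fun n => hasSum_geometric_two.mul_left _
  have hTsum : ∀ n, Summable (fun m => T m n) := fun n =>
    Summable.of_norm_bounded (hgeo n).summable (fun m => hTn m n)
  let Y : ℕ → A := fun n => ∑' m, T m n
  have hYn : ∀ n, ‖Y n‖ ≤ 2 := by
    intro n
    refine (tsum_of_norm_bounded (hgeo n) (fun m => hTn m n)).trans ?_
    have : (1 / 2 : ℝ) ^ n ≤ 1 := pow_le_one₀ (by norm_num) (by norm_num)
    linarith
  have hY : ∀ n, Y n = x n + b n * Y (n + 1) := by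
    intro n
    change ∑' m, T m n = x n + b n * ∑' m, T m (n + 1)
    rw [← (hTsum (n + 1)).tsum_mul_left]
    exact (hTsum n).tsum_eq_zero_add
  have hY0 : ∀ n, Y 0 = G n + L n (Y n) := by
    intro n
    induction n with
    | zero => rw [hL0]; exact (zero_add _).symm
    | succ n ih => rw [hG, hLs, ih, hY n, map_add, add_assoc]
  obtain ⟨n, hn⟩ := exists_nat_gt ‖d (Y 0)‖
  have h1 : ‖φ n (d (Y 0))‖ ≤ ‖d (Y 0)‖ := char_norm_le _ _
  have h2 : φ n (d (Y 0)) = φ n (d (G n)) + φ n (d (L n (x n)))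
      + α n * (φ n (d (b n)) * φ n (Y (n + 1))) := by
    rw [hY0 n, hY n, map_add, map_add, map_add, map_add, map_add, hβ' n (b n * _), hd, map_add,
      map_mul, map_mul, map_mul, hb0]
    ring
  have h3 : ‖α n * (φ n (d (b n)) * φ n (Y (n + 1)))‖ ≤ 2 * ‖α n‖ * ‖φ n (d (b n))‖ := by
    rw [norm_mul, norm_mul]
    have h4 : ‖φ n (Y (n + 1))‖ ≤ 2 := (char_norm_le _ _).trans (hYn _)
    calc ‖α n‖ * (‖φ n (d (b n))‖ * ‖φ n (Y (n + 1))‖) ≤ ‖α n‖ * (‖φ n (d (b n))‖ * 2) := by gcongr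
      _ = _ := by ring
  have h5 : (n : ℝ) + ‖φ n (d (G n))‖ + 2 * ‖α n‖ * ‖φ n (d (b n))‖ ≤ ‖φ n (d (L n (x n)))‖ :=
    hX2 n (G n)
  have h6 : ‖φ n (d (L n (x n)))‖ ≤ ‖φ n (d (Y 0))‖ + ‖φ n (d (G n))‖
      + ‖α n * (φ n (d (b n)) * φ n (Y (n + 1)))‖ := by
    have : φ n (d (L n (x n))) = φ n (d (Y 0)) - φ n (d (G n))
      - α n * (φ n (d (b n)) * φ n (Y (n + 1))) := by rw [h2]; ring
    rw [this]
    exact (norm_sub_le _ _).trans (by gcongr; exact norm_sub_le _ _)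
  linarith

lemma char_d_ran (hd : ∀ a x : A, d (a * x) = d a * x + a * d x)
    (φ : A →ₙₐ[ℂ] ℂ) (x : A) (hx : ∀ a, a * x = 0) : φ (d x) = 0 := by
  have h1 : d x * d x = 0 := by
    have := hd (d x) x
    rwa [hx, map_zero, hx, zero_add, eq_comm] at this
  have h2 := congrArg φ h1
  rw [map_mul, map_zero] at h2
  exact mul_self_eq_zero.1 h2

/-- All functionals `φ ∘ d` are continuous. -/
lemma all_continuous (hd : ∀ a x : A, d (a * x) = d a * x + a * d x)
    (hN : ∀ x : A, (∀ φ : A →ₙₐ[ℂ] ℂ, φ x = 0) → ∀ a, a * x = 0)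
    (φ : A →ₙₐ[ℂ] ℂ) : Continuous (fun x => φ (d x)) := by
  by_contra hφ
  let F : Set (A →ₙₐ[ℂ] ℂ) := {ψ | ¬ Continuous (fun x => ψ (d x))}
  have hF : F.Finite := by
    by_contra hinf
    have e := Set.Infinite.natEmbedding F hinf
    exact no_sequence d hd (fun n => (e n : A →ₙₐ[ℂ] ℂ))
      (fun m n h => e.injective (Subtype.ext h)) (fun n => (e n).2)
  have hφnz : ∃ x, φ x ≠ 0 := by
    by_contra! h
    exact hφ (by simpa [h] using continuous_const)
  have hs0 : ∃ s, φ s ≠ 0 ∧ ∀ ψ ∈ Fᶜ, ψ s = 0 := by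
    by_contra! h
    obtain ⟨f, hf, hfφ⟩ := exists_lift φ (kerInter Fᶜ) (fun x hx => by
      by_contra h0
      obtain ⟨ψ, hψ, hψx⟩ := h x h0
      exact hψx (hx ψ hψ))
    have h1 := hf.comp (mkQ_comp_continuous d Fᶜ (fun ψ hψ => not_not.1 hψ))
    exact hφ (h1.congr fun x => hfφ (d x))
  have hs1 : ∀ T : Finset (A →ₙₐ[ℂ] ℂ), φ ∉ T →
      ∃ s, φ s ≠ 0 ∧ (∀ ψ ∈ Fᶜ, ψ s = 0) ∧ ∀ ψ ∈ T, ψ s = 0 := by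
    classical
    intro T
    induction T using Finset.induction_on with
    | empty =>
      intro _
      obtain ⟨s, h1, h2⟩ := hs0
      exact ⟨s, h1, h2, by simp⟩
    | insert χ T _ ih =>
      intro hT
      rw [Finset.mem_insert, not_or] at hT
      obtain ⟨s, h1, h2, h3⟩ := ih hT.2
      obtain ⟨b, hb, hb'⟩ := char_separate φ χ hφnz hT.1
      refine ⟨b * s, ?_, ?_, ?_⟩
      · rw [map_mul]; exact mul_ne_zero hb' h1
      · intro ψ hψ
        rw [map_mul, h2 ψ hψ, mul_zero]
      · intro ψ hψ
        rw [map_mul]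
        rcases Finset.mem_insert.1 hψ with rfl | hψ
        · rw [hb, zero_mul]
        · rw [h3 ψ hψ, mul_zero]
  classical
  obtain ⟨s, hs, hs2, hs3⟩ := hs1 (hF.toFinset.erase φ) (by simp)
  have hs4 : ∀ ψ, ψ ≠ φ → ψ s = 0 := by
    intro ψ hne
    by_cases hψ : ψ ∈ F
    · exact hs3 ψ (by simp [hne, hψ])
    · exact hs2 ψ hψ
  -- for every `x`, `s * x - φ x • s` is killed by all characters
  have key : ∀ x, φ (d (s * x)) = φ x * φ (d s) := by
    intro x
    have h1 := char_d_ran d hd φ (s * x - φ x • s) (hN _ fun ψ => by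
      rw [map_sub, map_mul, map_smul, smul_eq_mul]
      by_cases hψ : ψ = φ
      · rw [hψ]; ring
      · rw [hs4 ψ hψ]; ring)
    rw [map_sub, map_sub, map_smul, map_smul, sub_eq_zero, smul_eq_mul] at h1
    exact h1
  have hds : φ (d s) = 0 := by
    have h1 := key s
    rw [hd, map_add, map_mul, map_mul] at h1
    have h2 : φ s * φ (d s) = 0 := by linear_combination h1
    exact (mul_eq_zero.1 h2).resolve_left hs
  apply hφ
  have hz : (fun x => φ (d x)) = fun _ => 0 := by
    ext x
    have h1 := key x
    rw [hd, map_add, map_mul, map_mul, hds] at h1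
    have h2 : φ s * φ (d x) = 0 := by linear_combination h1
    exact (mul_eq_zero.1 h2).resolve_left hs
  rw [hz]
  exact continuous_const

lemma order_mul (hd : ∀ a x : A, d (a * x) = d a * x + a * d x) (φ : A →ₙₐ[ℂ] ℂ) (n : ℕ) :
    ∀ c y : A, (∀ k < n, φ (d^[k] y) = 0) →
      (∀ k < n, φ (d^[k] (c * y)) = 0) ∧ φ (d^[n] (c * y)) = φ c * φ (d^[n] y) := by
  have hadd : ∀ (k : ℕ) (u v : A), d^[k] (u + v) = d^[k] u + d^[k] v := fun k u v =>
    iterate_map_add d k u v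
  induction n with
  | zero => intro c y _; simp
  | succ n ih =>
    intro c y hy
    have h1 := ih (d c) y (fun k hk => hy k (by omega))
    have h2 := ih c (d y) (fun k hk => by
      rw [← Function.iterate_succ_apply]; exact hy (k + 1) (by omega))
    have h3 := ih c y (fun k hk => hy k (by omega))
    refine ⟨fun k hk => ?_, ?_⟩
    · rcases Nat.lt_succ_iff_lt_or_eq.1 hk with hk | rfl
      · exact h3.1 k hk
      · rw [h3.2, hy k (by omega), mul_zero]
    · rw [Function.iterate_succ_apply, hd, hadd, map_add, h1.2, h2.2, hy n (by omega), mul_zero,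
        zero_add, ← Function.iterate_succ_apply]

lemma order_mul_ker (hd : ∀ a x : A, d (a * x) = d a * x + a * d x) (φ : A →ₙₐ[ℂ] ℂ) (a : A)
    (ha : φ a = 0) (n : ℕ) :
    ∀ y : A, (∀ k < n, φ (d^[k] y) = 0) →
      (∀ k < n + 1, φ (d^[k] (a * y)) = 0) ∧
        φ (d^[n + 1] (a * y)) = (n + 1) * φ (d a) * φ (d^[n] y) := by
  have hadd : ∀ (k : ℕ) (u v : A), d^[k] (u + v) = d^[k] u + d^[k] v := fun k u v =>
    iterate_map_add d k u v
  induction n with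
  | zero => intro y _; simp [ha, hd]
  | succ n ih =>
    intro y hy
    have h1 := order_mul d hd φ (n + 1) (d a) y hy
    have h2 := order_mul d hd φ (n + 1) a y hy
    have h3 := ih (d y) (fun k hk => by
      rw [← Function.iterate_succ_apply]; exact hy (k + 1) (by omega))
    refine ⟨fun k hk => ?_, ?_⟩
    · rcases Nat.lt_succ_iff_lt_or_eq.1 hk with hk | rfl
      · exact h2.1 k hk
      · rw [h2.2, ha, zero_mul]
    · rw [Function.iterate_succ_apply, hd, hadd, map_add, h1.2, h3.2,
        ← Function.iterate_succ_apply]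
      push_cast
      ring

lemma iter_formula (hd : ∀ a x : A, d (a * x) = d a * x + a * d x) (φ : A →ₙₐ[ℂ] ℂ) (a e : A)
    (ha : φ a = 0) (n : ℕ) :
    (∀ k < n, φ (d^[k] ((fun z => a * z)^[n] e)) = 0) ∧
      φ (d^[n] ((fun z => a * z)^[n] e)) = (n.factorial : ℂ) * φ (d a) ^ n * φ e := by
  induction n with
  | zero => simp
  | succ n ih =>
    have h := order_mul_ker d hd φ a ha n _ ih.1
    rw [Function.iterate_succ_apply' (fun z => a * z)]
    refine ⟨h.1, ?_⟩
    rw [h.2, ih.2, Nat.factorial_succ]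
    push_cast
    ring

/-- Growth bound for `φ ∘ d^n`. -/
lemma growth (hd : ∀ a x : A, d (a * x) = d a * x + a * d x)
    (hN : ∀ x : A, (∀ φ : A →ₙₐ[ℂ] ℂ, φ x = 0) → ∀ a, a * x = 0) (φ : A →ₙₐ[ℂ] ℂ) :
    ∃ C K : ℝ, 0 ≤ C ∧ 0 ≤ K ∧ ∀ n x, ‖φ (d^[n] x)‖ ≤ K * (C ^ n * ‖x‖) := by
  let I : Submodule ℂ A := kerInter Set.univ
  have hI : IsClosed (I : Set A) := kerInter_isClosed _
  have hc : Continuous (I.mkQ ∘ₗ d) :=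
    mkQ_comp_continuous d Set.univ (fun ψ _ => all_continuous d hd hN ψ)
  have hdI : I ≤ LinearMap.ker (I.mkQ ∘ₗ d) := by
    intro x hx
    rw [LinearMap.mem_ker, LinearMap.comp_apply, Submodule.mkQ_apply,
      Submodule.Quotient.mk_eq_zero]
    intro ψ _
    exact char_d_ran d hd ψ x (hN x fun χ => hx χ trivial)
  let D : (A ⧸ I) →ₗ[ℂ] (A ⧸ I) := I.liftQ (I.mkQ ∘ₗ d) hdI
  have hD : ∀ x, D (I.mkQ x) = I.mkQ (d x) := fun x => rfl
  have hDc : Continuous D := I.isOpenQuotientMap_mkQ.isQuotientMap.continuous_iff.2 hc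
  let D' : (A ⧸ I) →L[ℂ] (A ⧸ I) := ⟨D, hDc⟩
  obtain ⟨f, hf, hfφ⟩ := exists_lift φ I (fun x hx => hx φ trivial)
  let f' : (A ⧸ I) →L[ℂ] ℂ := ⟨f, hf⟩
  refine ⟨‖D'‖, ‖f'‖, D'.opNorm_nonneg, f'.opNorm_nonneg, fun n x => ?_⟩
  have h1 : ∀ n, ‖I.mkQ (d^[n] x)‖ ≤ ‖D'‖ ^ n * ‖x‖ := by
    intro n
    induction n with
    | zero => simpa using Submodule.Quotient.norm_mk_le I x
    | succ n ih =>
      rw [Function.iterate_succ_apply', ← hD]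
      calc ‖D' (I.mkQ (d^[n] x))‖ ≤ ‖D'‖ * ‖I.mkQ (d^[n] x)‖ := D'.le_opNorm _
        _ ≤ ‖D'‖ * (‖D'‖ ^ n * ‖x‖) := by gcongr
        _ = _ := by ring
  rw [← hfφ]
  calc ‖f' (I.mkQ (d^[n] x))‖ ≤ ‖f'‖ * ‖I.mkQ (d^[n] x)‖ := f'.le_opNorm _
    _ ≤ _ := by gcongr; exact h1 n

lemma char_d_eq_zero (hd : ∀ a x : A, d (a * x) = d a * x + a * d x)
    (hN : ∀ x : A, (∀ φ : A →ₙₐ[ℂ] ℂ, φ x = 0) → ∀ a, a * x = 0) (φ : A →ₙₐ[ℂ] ℂ) (x : A) :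
    φ (d x) = 0 := by
  by_cases hφ : ∃ y, φ y ≠ 0
  swap
  · push Not at hφ
    exact hφ _
  obtain ⟨y, hy⟩ := hφ
  set e : A := (φ y)⁻¹ • y with he
  have hφe : φ e = 1 := by rw [he, map_smul, smul_eq_mul, inv_mul_cancel₀ hy]
  obtain ⟨C, K, hC, hK, hgr⟩ := growth d hd hN φ
  have key : ∀ a, φ a = 0 → φ (d a) = 0 := by
    intro a ha
    by_contra hne
    have hp : 0 < ‖φ (d a)‖ := norm_pos_iff.2 hne
    have hit : ∀ n, ‖(fun z => a * z)^[n] e‖ ≤ ‖a‖ ^ n * ‖e‖ := by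
      intro n
      induction n with
      | zero => simp
      | succ n ih =>
        rw [Function.iterate_succ_apply']
        calc _ ≤ ‖a‖ * ‖(fun z => a * z)^[n] e‖ := norm_mul_le _ _
          _ ≤ ‖a‖ * (‖a‖ ^ n * ‖e‖) := by gcongr
          _ = _ := by ring
    have hle : ∀ n : ℕ, 1 ≤ K * ‖e‖ * ((C * ‖a‖ / ‖φ (d a)‖) ^ n / n.factorial) := by
      intro n
      have h1 := hgr n ((fun z => a * z)^[n] e)
      rw [(iter_formula d hd φ a e ha n).2, hφe, mul_one, norm_mul, norm_pow,
        Complex.norm_natCast] at h1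
      have h2 : (n.factorial : ℝ) * ‖φ (d a)‖ ^ n ≤ K * (C ^ n * (‖a‖ ^ n * ‖e‖)) :=
        h1.trans (by gcongr; exact hit n)
      have hf : (0 : ℝ) < n.factorial := by exact_mod_cast n.factorial_pos
      have h3 : K * ‖e‖ * ((C * ‖a‖ / ‖φ (d a)‖) ^ n / n.factorial) =
          K * (C ^ n * (‖a‖ ^ n * ‖e‖)) / ((n.factorial : ℝ) * ‖φ (d a)‖ ^ n) := by
        rw [div_pow, mul_pow]
        field_simp
      rw [h3, le_div_iff₀ (by positivity), one_mul]
      exact h2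
    have hlim := (FloorSemiring.tendsto_pow_div_factorial_atTop
      (C * ‖a‖ / ‖φ (d a)‖)).const_mul (K * ‖e‖)
    have := ge_of_tendsto' hlim hle
    rw [mul_zero] at this
    linarith
  have hde : φ (d e) = 0 := by
    have := key (e * e - e) (by rw [map_sub, map_mul, hφe]; ring)
    rw [map_sub, map_sub, hd, map_add, map_mul, map_mul, hφe] at this
    linear_combination this
  have := key (x - φ x • e) (by rw [map_sub, map_smul, hφe]; simp)
  rw [map_sub, map_sub, map_smul, map_smul, hde] at this
  simpa using this

end Johnson

/-- Let `A` be a complex Banach algebra such that the quotient `A / ran(A)`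
by the right annihilator is commutative and semisimple (its Jacobson radical is zero; for the
possibly non-unital ring `A / ran(A)` this means that the only element whose image in the
unitization lies in the Jacobson radical of the unitization is `0`).  Then every derivation
`d` of `A` is spectrally infinitesimal: the spectral radius of `d a` (computed in the
unitization of `A`) is zero for every `a ∈ A`. -/
theorem derivation_spectrally_infinitesimal
    {A : Type*} [NonUnitalNormedRing A] [NormedSpace ℂ A]
    [IsScalarTower ℂ A A] [SMulCommClass ℂ A A] [CompleteSpace A]
    (hcomm : ∀ x y : RanQuot A, x * y = y * x)
    (hss : ∀ x : RanQuot A,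
      (↑x : Unitization ℤ (RanQuot A)) ∈ (⊥ : Ideal (Unitization ℤ (RanQuot A))).jacobson →
        x = 0)
    (d : A →ₗ[ℂ] A) (hd : ∀ a x : A, d (a * x) = d a * x + a * d x) :
    ∀ a : A, spectralRadius ℂ ((d a : A) : Unitization ℂ A) = 0 := by
  intro a
  have hN := ran_of_char hcomm hss
  have h1 : d a * d a = 0 := hN (d a) (fun φ => char_d_eq_zero d hd hN φ a) (d a)
  have h2 : ((d a : A) : Unitization ℂ A) ^ 2 = 0 := by
    rw [pow_two, ← Unitization.inr_mul, h1, Unitization.inr_zero]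
  unfold spectralRadius
  simp only [ENNReal.iSup_eq_zero]
  intro k hk
  have h3 := spectrum.pow_image_subset ((d a : A) : Unitization ℂ A) 2 ⟨k, hk, rfl⟩
  rw [h2, spectrum.zero_eq] at h3
  have h4 : k = 0 := by simpa using h3
  simp [h4]
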